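/- arXiv:1109.4381 — 2 statements merged into one kernel-verified Lean document; each statement's English description precedes it below -/
import Mathlib

section
/- (Reduction of Y^{π₁}_{1,1} is the Deligne–Lusztig curve.) Suppose u, X, Y ∈ K with v(u) ≥ q/(q+1), X ≠ 0, Y ≠ 0, [π]_u(X) = [π]_u(Y) = 0, and X^q Y − X Y^q = π₁, and let α ∈ K with α^{q+1} = π₁. Then v(X) = v(Y) = 1/(q²−1), and the elements x = X/α, y = Y/α satisfy v(x) = v(y) = 0 and x^q y − x y^q = 1; in particular the residues of x and y satisfy the Deligne–Lusztig equation x̄^q ȳ − x̄ ȳ^q = 1. -/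
section Valuation

variable {K : Type*} [Field K] {v : K → WithTop ℝ}

theorem exists_real_eq_valuation (hv_top : ∀ x : K, v x = ⊤ ↔ x = 0) {x : K} (hx : x ≠ 0) :
    ∃ r : ℝ, v x = (r : WithTop ℝ) := by
  obtain ⟨r, hr⟩ := WithTop.ne_top_iff_exists.mp (mt (hv_top x).mp hx)
  exact ⟨r, hr.symm⟩

theorem valuation_one_eq_zero (hv_top : ∀ x : K, v x = ⊤ ↔ x = 0)
    (hv_mul : ∀ x y : K, v (x * y) = v x + v y) : v 1 = 0 := by
  obtain ⟨r, hr⟩ := exists_real_eq_valuation hv_top (one_ne_zero (α := K))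
  have h := hv_mul 1 1
  rw [mul_one, hr] at h
  norm_cast at h
  rw [hr]
  norm_cast
  linarith

theorem valuation_neg_eq (hv_top : ∀ x : K, v x = ⊤ ↔ x = 0)
    (hv_mul : ∀ x y : K, v (x * y) = v x + v y) (x : K) : v (-x) = v x := by
  obtain ⟨r, hr⟩ := exists_real_eq_valuation hv_top (neg_ne_zero.mpr (one_ne_zero (α := K)))
  have h := hv_mul (-1) (-1)
  rw [neg_mul_neg, mul_one, valuation_one_eq_zero hv_top hv_mul, hr] at h
  norm_cast at h
  have hr0 : r = 0 := by linarith
  rw [← neg_one_mul, hv_mul, hr, hr0]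
  simp

theorem valuation_pow_eq (hv_top : ∀ x : K, v x = ⊤ ↔ x = 0)
    (hv_mul : ∀ x y : K, v (x * y) = v x + v y) {x : K} {r : ℝ} (hx : v x = (r : WithTop ℝ))
    (n : ℕ) : v (x ^ n) = ((n * r : ℝ) : WithTop ℝ) := by
  induction n with
  | zero => simp [valuation_one_eq_zero hv_top hv_mul]
  | succ n ih =>
    rw [pow_succ, hv_mul, ih, hx, ← WithTop.coe_add]
    congr 1
    push_cast
    ring

theorem min_valuation_le_of_add_eq_zero (hv_top : ∀ x : K, v x = ⊤ ↔ x = 0)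
    (hv_mul : ∀ x y : K, v (x * y) = v x + v y)
    (hv_add : ∀ x y : K, min (v x) (v y) ≤ v (x + y)) {a b c : K} (h : a + b + c = 0) :
    min (v a) (v b) ≤ v c := by
  rw [← valuation_neg_eq hv_top hv_mul c, ← eq_neg_of_add_eq_zero_left h]
  exact hv_add a b

theorem valuation_div_eq_zero (hv_top : ∀ x : K, v x = ⊤ ↔ x = 0)
    (hv_mul : ∀ x y : K, v (x * y) = v x + v y) {x y : K} (hy : y ≠ 0) (h : v x = v y) :
    v (x / y) = 0 := by
  have hxy := hv_mul (x / y) y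
  rw [div_mul_cancel₀ x hy, h] at hxy
  exact (WithTop.add_right_cancel (mt (hv_top y).mp hy) ((zero_add _).trans hxy)).symm

/-- Nonzero `π`-torsion has valuation `1 / (q ^ 2 - 1)` on the locus `v u ≥ q / (q + 1)`, where the
Newton polygon of the `π`-multiplication has a single slope. -/
theorem valuation_torsion_eq (hv_top : ∀ x : K, v x = ⊤ ↔ x = 0)
    (hv_mul : ∀ x y : K, v (x * y) = v x + v y)
    (hv_add : ∀ x y : K, min (v x) (v y) ≤ v (x + y)) {q : ℕ} (hq : 1 < q)
    {π u X : K} (hπ : v π = 1)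
    (hu : (((q : ℝ) / ((q : ℝ) + 1) : ℝ) : WithTop ℝ) ≤ v u) (hX : X ≠ 0)
    (htor : X ^ q ^ 2 + u * X ^ q + π * X = 0) :
    v X = ((1 / ((q : ℝ) ^ 2 - 1) : ℝ) : WithTop ℝ) := by
  obtain ⟨a, ha⟩ := exists_real_eq_valuation hv_top hX
  have hq1 : (1 : ℝ) < q := by exact_mod_cast hq
  have hpos : (0 : ℝ) < (q : ℝ) ^ 2 - 1 := by nlinarith
  have hlead : v (X ^ q ^ 2) = (((q : ℝ) ^ 2 * a : ℝ) : WithTop ℝ) := by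
    rw [valuation_pow_eq hv_top hv_mul ha]
    push_cast
    rfl
  have hmid : (((q : ℝ) / ((q : ℝ) + 1) + q * a : ℝ) : WithTop ℝ) ≤ v (u * X ^ q) := by
    rw [hv_mul, valuation_pow_eq hv_top hv_mul ha, WithTop.coe_add]
    gcongr
  have hlin : v (π * X) = ((1 + a : ℝ) : WithTop ℝ) := by
    rw [hv_mul, hπ, ha]
    rfl
  have hdiv : (q : ℝ) / (q + 1) * (q + 1) = q := div_mul_cancel₀ _ (by positivity)
  rw [ha]
  congr 1
  rw [eq_div_iff hpos.ne']
  rcases lt_trichotomy (a * ((q : ℝ) ^ 2 - 1)) 1 with h | h | h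
  · exfalso
    have hmin := min_valuation_le_of_add_eq_zero hv_top hv_mul hv_add
      (a := u * X ^ q) (b := π * X) (c := X ^ q ^ 2) (by rw [← htor]; ring)
    have hle := (min_le_min_right _ hmid).trans hmin
    rw [hlin, hlead] at hle
    rcases min_le_iff.mp hle with h' | h' <;> rw [WithTop.coe_le_coe] at h'
    · nlinarith [mul_le_mul_of_nonneg_right h' (by positivity : (0 : ℝ) ≤ (q : ℝ) + 1)]
    · linarith
  · exact h
  · exfalso
    have hmin := min_valuation_le_of_add_eq_zero hv_top hv_mul hv_add htor
    have hle := (min_le_min_left _ hmid).trans hmin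
    rw [hlin, hlead] at hle
    rcases min_le_iff.mp hle with h' | h' <;> rw [WithTop.coe_le_coe] at h'
    · linarith
    · nlinarith [mul_le_mul_of_nonneg_right h' (by positivity : (0 : ℝ) ≤ (q : ℝ) + 1)]

end Valuation


/-- on the too-supersingular locus v(u) ≥ q/(q+1), a Drinfeld basis (X,Y)
of the π-torsion satisfies v(X) = v(Y) = 1/(q²−1), and after rescaling by α with
α^{q+1} = π₁ the pair (x, y) = (X/α, Y/α) has v(x) = v(y) = 0 and satisfies the
Deligne–Lusztig equation x^q y − x y^q = 1 (so the residues do as well). -/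
theorem stmt_4 (p f q : ℕ) (hp : p.Prime) (hf : 0 < f) (hq : q = p ^ f)
    (K : Type*) [Field K] [IsAlgClosed K] [CharP K p]
    (v : K → WithTop ℝ)
    (hv_top : ∀ x : K, v x = ⊤ ↔ x = 0)
    (hv_mul : ∀ x y : K, v (x * y) = v x + v y)
    (hv_add : ∀ x y : K, min (v x) (v y) ≤ v (x + y))
    (π : K) (hπ : v π = 1)
    (π₁ : K) (hπ₁ : π₁ ^ (q - 1) = π)
    (u X Y : K) (hu : (((q : ℝ) / ((q : ℝ) + 1) : ℝ) : WithTop ℝ) ≤ v u)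
    (hX : X ≠ 0) (hY : Y ≠ 0)
    (htorX : X ^ q ^ 2 + u * X ^ q + π * X = 0)
    (htorY : Y ^ q ^ 2 + u * Y ^ q + π * Y = 0)
    (hMoore : X ^ q * Y - X * Y ^ q = π₁)
    (α : K) (hα : α ^ (q + 1) = π₁) :
    v X = ((1 / ((q : ℝ) ^ 2 - 1) : ℝ) : WithTop ℝ) ∧
    v Y = ((1 / ((q : ℝ) ^ 2 - 1) : ℝ) : WithTop ℝ) ∧
    v (X / α) = 0 ∧ v (Y / α) = 0 ∧
    (X / α) ^ q * (Y / α) - (X / α) * (Y / α) ^ q = 1 := by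
  have hq1 : 1 < q := hq ▸ Nat.one_lt_pow hf.ne' hp.one_lt
  have hqr : (1 : ℝ) < q := by exact_mod_cast hq1
  have hvX := valuation_torsion_eq hv_top hv_mul hv_add hq1 hπ hu hX htorX
  have hvY := valuation_torsion_eq hv_top hv_mul hv_add hq1 hπ hu hY htorY
  have hα0 : α ≠ 0 := by
    rintro rfl
    have hπ0 : π = 0 := by
      rw [← hπ₁, ← hα, zero_pow q.succ_ne_zero, zero_pow (by omega)]
    rw [(hv_top π).mpr hπ0] at hπ
    exact WithTop.top_ne_one hπ
  have hvα : v α = ((1 / ((q : ℝ) ^ 2 - 1) : ℝ) : WithTop ℝ) := by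
    obtain ⟨a, ha⟩ := exists_real_eq_valuation hv_top hα0
    have h := valuation_pow_eq hv_top hv_mul ha ((q + 1) * (q - 1))
    rw [pow_mul, hα, hπ₁, hπ] at h
    have h' : (1 : ℝ) = ((q + 1) * (q - 1) : ℕ) * a := by exact_mod_cast h
    rw [Nat.cast_mul, Nat.cast_sub hq1.le] at h'
    push_cast at h'
    rw [ha]
    congr 1
    rw [eq_div_iff (by nlinarith)]
    linarith
  refine ⟨hvX, hvY, valuation_div_eq_zero hv_top hv_mul hα0 (hvX.trans hvα.symm),
    valuation_div_eq_zero hv_top hv_mul hα0 (hvY.trans hvα.symm), ?_⟩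
  calc (X / α) ^ q * (Y / α) - (X / α) * (Y / α) ^ q
      = (X ^ q * Y - X * Y ^ q) / α ^ (q + 1) := by
        rw [div_pow, div_pow, pow_succ]
        field_simp
    _ = 1 := by rw [hMoore, ← hα, div_self (pow_ne_zero _ hα0)]
end

section
/- (Blow-up of a singular residue class of Y^{π₂}_{2,2}: an Artin–Schreier curve a^q − a = t^{q+1} appears.) Let γ₁ ∈ K with v(γ₁) = (q−1)/q³, let γ₀ ∈ K with γ₀^q + γ₁ γ₀ + 1 = 0, let β ∈ K with β^{q−1} = −γ₁, and let β₁ ∈ K with β₁^{q+1} = β^q. Suppose Z, s₁ ∈ K satisfy v(s₁) = 1/(q²(q+1)) and v(Z^q + 1 + γ₁ Z + s₁^{q+1}) > 1/q². Then a := (Z − γ₀)/β and s₂ := s₁/β₁ satisfy v(a) = 0, v(s₂) = 0, and v(a^q − a + s₂^{q+1}) > 0; that is, the residues satisfy ā^q − ā = −s̄₂^{q+1}. -/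
/-- An additive valuation on a field, given by its defining inequalities, as an `AddValuation`. -/
noncomputable def addValuationOfField {K : Type*} [Field K] (v : K → WithTop ℝ)
    (hv_top : ∀ x : K, v x = ⊤ ↔ x = 0)
    (hv_mul : ∀ x y : K, v (x * y) = v x + v y)
    (hv_add : ∀ x y : K, min (v x) (v y) ≤ v (x + y)) :
    AddValuation K (WithTop ℝ) :=
  AddValuation.of v ((hv_top 0).2 rfl)
    (by
      have h1 := hv_mul 1 1
      have hne : v 1 ≠ ⊤ := fun h => one_ne_zero ((hv_top 1).1 h)
      obtain ⟨r, hr⟩ := WithTop.ne_top_iff_exists.1 hne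
      rw [mul_one, ← hr] at h1
      rw [← hr]
      norm_cast at h1 ⊢
      linarith)
    hv_add hv_mul

/-- If `x ^ n` has valuation `n * r`, then `x` has valuation `r`. -/
theorem AddValuation.eq_coe_of_map_pow {K : Type*} [Field K] (w : AddValuation K (WithTop ℝ))
    {x : K} {n : ℕ} (hn : n ≠ 0) {r : ℝ} (h : w (x ^ n) = ((n * r : ℝ) : WithTop ℝ)) :
    w x = (r : WithTop ℝ) := by
  have hne : w x ≠ ⊤ := by
    intro hx
    rw [AddValuation.top_iff] at hx
    rw [hx, zero_pow hn, AddValuation.map_zero] at h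
    exact WithTop.coe_ne_top h.symm
  obtain ⟨s, hs⟩ := WithTop.ne_top_iff_exists.1 hne
  rw [AddValuation.map_pow, ← hs] at h
  rw [← hs]
  norm_cast at h ⊢
  rw [nsmul_eq_mul] at h
  exact mul_left_cancel₀ (Nat.cast_ne_zero.2 hn) h

/-- If `a ^ n - a` is a unit for the valuation, then so is `a`. -/
theorem AddValuation.map_eq_zero_of_map_pow_sub_self {K : Type*} [Field K]
    (w : AddValuation K (WithTop ℝ)) {a : K} {n : ℕ} (hn : 2 ≤ n) (h : w (a ^ n - a) = 0) :
    w a = 0 := by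
  have hne : w a ≠ ⊤ := by
    intro hx
    rw [AddValuation.top_iff] at hx
    rw [hx, zero_pow (by omega), sub_zero, AddValuation.map_zero] at h
    exact WithTop.coe_ne_top h.symm
  have hn' : (2 : ℝ) ≤ n := by exact_mod_cast hn
  obtain ⟨r, hr⟩ := WithTop.ne_top_iff_exists.1 hne
  have hpow : w (a ^ n) = ((n * r : ℝ) : WithTop ℝ) := by
    rw [AddValuation.map_pow, ← hr]
    norm_cast
    rw [nsmul_eq_mul]
  rcases lt_trichotomy r 0 with hneg | hzero | hpos
  · have hlt : w (a ^ n) < w a := by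
      rw [hpow, ← hr, WithTop.coe_lt_coe]
      nlinarith
    rw [AddValuation.map_sub_eq_of_lt_left w hlt, hpow] at h
    norm_cast at h
    nlinarith
  · rw [← hr, hzero]
    rfl
  · have hle := w.map_sub (a ^ n) a
    rw [h, hpow, ← hr, ← WithTop.coe_min, ← WithTop.coe_zero, WithTop.coe_le_coe] at hle
    have : 0 < min (n * r) r := lt_min (by nlinarith) hpos
    linarith


/-- blow-up of a singular residue class of Y^{π₂}_{2,2}: an
Artin–Schreier curve a^q − a = t^{q+1} appears. -/
theorem stmt_11 (p f q : ℕ) (hp : p.Prime) (hf : 0 < f) (hq : q = p ^ f)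
    (K : Type*) [Field K] [IsAlgClosed K] [CharP K p]
    (v : K → WithTop ℝ)
    (hv_top : ∀ x : K, v x = ⊤ ↔ x = 0)
    (hv_mul : ∀ x y : K, v (x * y) = v x + v y)
    (hv_add : ∀ x y : K, min (v x) (v y) ≤ v (x + y))
    (γ₁ : K) (hγ₁ : v γ₁ = ((((q : ℝ) - 1) / (q : ℝ) ^ 3 : ℝ) : WithTop ℝ))
    (γ₀ : K) (hγ₀ : γ₀ ^ q + γ₁ * γ₀ + 1 = 0)
    (β : K) (hβ : β ^ (q - 1) = -γ₁)
    (β₁ : K) (hβ₁ : β₁ ^ (q + 1) = β ^ q)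
    (Z s₁ : K)
    (hs₁ : v s₁ = ((1 / ((q : ℝ) ^ 2 * ((q : ℝ) + 1)) : ℝ) : WithTop ℝ))
    (hcong : ((1 / (q : ℝ) ^ 2 : ℝ) : WithTop ℝ) < v (Z ^ q + 1 + γ₁ * Z + s₁ ^ (q + 1)))
    (a s₂ : K) (ha : a = (Z - γ₀) / β) (hs₂ : s₂ = s₁ / β₁) :
    v a = 0 ∧ v s₂ = 0 ∧ 0 < v (a ^ q - a + s₂ ^ (q + 1)) := by
  obtain ⟨w, hw⟩ : ∃ w : AddValuation K (WithTop ℝ), ∀ x, w x = v x :=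
    ⟨addValuationOfField v hv_top hv_mul hv_add, fun _ => rfl⟩
  simp only [← hw] at hγ₁ hs₁ hcong ⊢
  have : Fact p.Prime := ⟨hp⟩
  have hq2 : 2 ≤ q := by
    rw [hq]
    exact hp.two_le.trans (Nat.le_self_pow hf.ne' p)
  have hqR : (2 : ℝ) ≤ q := by exact_mod_cast hq2
  have hq0 : (q : ℝ) ≠ 0 := by positivity
  have hvβ : w β = ((1 / (q : ℝ) ^ 3 : ℝ) : WithTop ℝ) := by
    refine w.eq_coe_of_map_pow (n := q - 1) (by omega) ?_
    rw [hβ, AddValuation.map_neg, hγ₁, Nat.cast_sub (by omega), Nat.cast_one, mul_one_div]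
  have hvβq : w (β ^ q) = ((1 / (q : ℝ) ^ 2 : ℝ) : WithTop ℝ) := by
    rw [AddValuation.map_pow, hvβ, ← WithTop.coe_nsmul, nsmul_eq_mul]
    congr 1
    field_simp
  have hvβ₁ : w β₁ = ((1 / ((q : ℝ) ^ 2 * ((q : ℝ) + 1)) : ℝ) : WithTop ℝ) := by
    refine w.eq_coe_of_map_pow (n := q + 1) (by omega) ?_
    rw [hβ₁, hvβq]
    congr 1
    push_cast
    field_simp
  have hβ0 : β ≠ 0 := by
    rw [Ne, ← w.top_iff, hvβ]
    exact WithTop.coe_ne_top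
  have hβ₁0 : β₁ ≠ 0 := by
    rw [Ne, ← w.top_iff, hvβ₁]
    exact WithTop.coe_ne_top
  have hZ : Z = γ₀ + β * a := by
    rw [ha]
    field_simp
    ring
  have hs : s₁ = β₁ * s₂ := by
    rw [hs₂]
    field_simp
  have hvs₂ : w s₂ = 0 := by
    rw [hs, AddValuation.map_mul, hvβ₁] at hs₁
    exact (WithTop.add_left_inj WithTop.coe_ne_top).1 (hs₁.trans (add_zero _).symm)
  have hβq : β ^ q = -γ₁ * β := by
    rw [← hβ, ← pow_succ, Nat.sub_add_cancel (by omega)]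
  have hfrob : (γ₀ + β * a) ^ q = γ₀ ^ q + (β * a) ^ q := by
    rw [hq]
    exact add_pow_char_pow ..
  have hfactor : Z ^ q + 1 + γ₁ * Z + s₁ ^ (q + 1)
      = β ^ q * (a ^ q - a + s₂ ^ (q + 1)) := by
    rw [hZ, hs, hfrob, mul_pow, mul_pow, hβ₁]
    linear_combination hγ₀ + a * hβq
  have hpos : 0 < w (a ^ q - a + s₂ ^ (q + 1)) := by
    rw [hfactor, AddValuation.map_mul, hvβq] at hcong
    exact (WithTop.add_lt_add_iff_left WithTop.coe_ne_top).1 ((add_zero _).trans_lt hcong)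
  refine ⟨w.map_eq_zero_of_map_pow_sub_self hq2 ?_, hvs₂, hpos⟩
  have hvpow : w (s₂ ^ (q + 1)) = 0 := by
    rw [AddValuation.map_pow, hvs₂, smul_zero]
  have hsub := AddValuation.map_sub_eq_of_lt_right w (hvpow.trans_lt hpos)
  rwa [add_sub_cancel_right, hvpow] at hsub
end
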